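/- arXiv:2311.11151 — 3 statements merged into one kernel-verified Lean document; each statement's English description precedes it below -/
import Mathlib

section
/- Assume r > 1 and 0 < v < (r−1)/2. Let K ∈ ℝ^{1×n} be any gain such that A + B₁K is stable, let χ be the characteristic polynomial of A + B₁K, and let p₁,…,pₙ be its complex eigenvalues counted with multiplicity (each of modulus < 1). Then the first entry k₁ of K satisfies k₁ = −χ(r)/vⁿ = −∏ᵢ₌₁ⁿ (r − pᵢ)/vⁿ. -/
open Matrix Polynomial

noncomputable section

/-- The state matrix `A`: `A₁,₁ = r`, superdiagonal entries `v`, all else `0`. -/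
def matA (n : ℕ) (r v : ℝ) : Matrix (Fin n) (Fin n) ℝ :=
  Matrix.of fun i j => if (i : ℕ) = 0 ∧ (j : ℕ) = 0 then r
    else if (j : ℕ) = (i : ℕ) + 1 then v else 0

/-- The input vector `B(b)`: first entry `b`, last entry `v`, all else `0`. -/
def vecB (n : ℕ) (v b : ℝ) : Fin n → ℝ :=
  fun i => if (i : ℕ) = 0 then b else if (i : ℕ) = n - 1 then v else 0

/-- A real square matrix is stable if every complex eigenvalue (root of its
characteristic polynomial) has modulus strictly less than `1`. -/
def IsStable {n : ℕ} (M : Matrix (Fin n) (Fin n) ℝ) : Prop :=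
  ∀ z : ℂ, ((Matrix.charpoly M).map (algebraMap ℝ ℂ)).IsRoot z → ‖z‖ < 1

lemma charpoly_eval_r (m : ℕ) (hm : 1 ≤ m) (r v : ℝ) (K : Fin (m + 1) → ℝ) :
    (Matrix.charpoly (matA (m + 1) r v + Matrix.vecMulVec (vecB (m + 1) v 0) K)).eval r
      = -(K 0 * v ^ (m + 1)) := by
  rw [Matrix.eval_charpoly, Matrix.det_succ_column_zero, Finset.sum_eq_single (Fin.last m)]
  · rw [Matrix.det_of_isLowerTriangular]
    · have hm0 : m ≠ 0 := by omega
      have hd : ∀ i : Fin m, ((Matrix.scalar (Fin (m + 1)) r -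
          (matA (m + 1) r v + Matrix.vecMulVec (vecB (m + 1) v 0) K)).submatrix
          (Fin.last m).succAbove Fin.succ) i i = -v := by
        intro i
        have hi : (i : ℕ) ≠ m := by omega
        have hne : i.castSucc ≠ i.succ := by
          intro h
          have := congrArg Fin.val h
          simp at this
        simp [matA, vecB, Matrix.vecMulVec_apply, Matrix.diagonal_apply, hi, hne]
      rw [Finset.prod_congr rfl (fun i _ => hd i)]
      have hl : Fin.last m ≠ 0 := by
        intro h
        have := congrArg Fin.val h
        simp at this
        omega
      simp [matA, vecB, Matrix.vecMulVec_apply, Matrix.diagonal_apply, hm0, hl]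
      have h1 : ((-1 : ℝ)) ^ m * (-v) ^ m = v ^ m := by
        rw [← mul_pow]; simp
      linear_combination (v * K 0) * h1
    · intro i j hij
      have hij' : (i : ℕ) < (j : ℕ) := by simpa using hij
      have hi : (i : ℕ) ≠ m := by omega
      have hne : i.castSucc ≠ j.succ := by
        intro h
        have := congrArg Fin.val h
        simp at this
        omega
      have hji : (j : ℕ) ≠ i := by omega
      simp [matA, vecB, Matrix.vecMulVec_apply, Matrix.diagonal_apply, hi, hne, hji]
  · intro i _ hi
    have him : (i : ℕ) ≠ m := by
      intro h
      exact hi (Fin.ext h)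
    by_cases h0 : i = 0
    · subst h0
      simp [matA, vecB, Matrix.vecMulVec_apply]
    · simp [matA, vecB, Matrix.vecMulVec_apply, Matrix.diagonal_apply, him, h0]
  · simp

theorem stmt4 (n : ℕ) (hn : 2 ≤ n) (r v : ℝ) (hr : 1 < r) (hv0 : 0 < v)
    (hv : v < (r - 1) / 2) (K : Fin n → ℝ)
    (hstab : IsStable (matA n r v + Matrix.vecMulVec (vecB n v 0) K))
    (p : Fin n → ℂ)
    (hfact : (Matrix.charpoly (matA n r v + Matrix.vecMulVec (vecB n v 0) K)).map
        (algebraMap ℝ ℂ) = ∏ i : Fin n, (X - C (p i)))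
    (hmod : ∀ i, ‖p i‖ < 1) :
    K (⟨0, by omega⟩ : Fin n) =
      -(Matrix.charpoly (matA n r v + Matrix.vecMulVec (vecB n v 0) K)).eval r / v ^ n ∧
    (K (⟨0, by omega⟩ : Fin n) : ℂ) =
      -(∏ i : Fin n, ((r : ℂ) - p i)) / (v : ℂ) ^ n := by
  obtain ⟨m, rfl⟩ : ∃ m, n = m + 1 := ⟨n - 1, by omega⟩
  have key := charpoly_eval_r m (by omega) r v K
  have hvn : v ^ (m + 1) ≠ 0 := pow_ne_zero _ hv0.ne'
  have h1 : K (⟨0, by omega⟩ : Fin (m + 1)) = K 0 := rfl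
  rw [h1]
  have hp : ((-(K 0 * v ^ (m + 1)) : ℝ) : ℂ) = ∏ i, ((r : ℂ) - p i) := by
    have h2 := congrArg (Polynomial.eval (r : ℂ)) hfact
    rw [Polynomial.eval_prod] at h2
    simp only [Polynomial.eval_sub, Polynomial.eval_X, Polynomial.eval_C] at h2
    rw [← h2, ← key]
    exact (Polynomial.eval_map_apply (algebraMap ℝ ℂ) r).symm
  refine ⟨?_, ?_⟩
  · rw [key]; field_simp
  · have hvc : (v : ℂ) ≠ 0 := by exact_mod_cast hv0.ne'
    rw [← hp]; push_cast; field_simp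
end
end

section
/- Assume r > 1, 0 < v < (r−1)/2, and m ≥ 0. Let K ∈ ℝ^{1×n} be any gain such that A + B₁K is stable; let χ be the characteristic polynomial of A + B₁K and p₁,…,pₙ its complex eigenvalues counted with multiplicity (each of modulus < 1). If A + B₂K is also stable, then m · χ(r) < vⁿ · (−1)ⁿ · χ(−1); equivalently, since χ(r) = ∏ᵢ(r − pᵢ) and (−1)ⁿ χ(−1) = ∏ᵢ(1 + pᵢ) are positive real numbers, 0 ≤ m < vⁿ ∏ᵢ₌₁ⁿ (1 + pᵢ)/(r − pᵢ). -/
open Matrix Polynomial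

noncomputable section

theorem aux_pos (q : ℝ[X]) (hq : q.Monic) (hd : 0 < q.degree)
    (h : ∀ t : ℝ, 1 ≤ t → q.eval t ≠ 0) (x : ℝ) (hx : 1 ≤ x) : 0 < q.eval x := by
  by_contra hneg
  have hle : q.eval x ≤ 0 := not_lt.mp hneg
  have ht := Polynomial.tendsto_atTop_of_leadingCoeff_nonneg q hd (by rw [hq.leadingCoeff]; norm_num)
  obtain ⟨y, hy0, hyx⟩ := ((ht.eventually_ge_atTop 0).and (Filter.eventually_ge_atTop x)).exists
  obtain ⟨c, hc, hc0⟩ := intermediate_value_Icc hyx (q.continuous.continuousOn) ⟨hle, hy0⟩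
  exact h c (hx.trans hc.1) hc0

theorem aux_pos_stable {n : ℕ} (hn : 0 < n) (M : Matrix (Fin n) (Fin n) ℝ) (hM : IsStable M) :
    (∀ x : ℝ, 1 ≤ x → 0 < M.charpoly.eval x) ∧ 0 < (-1 : ℝ) ^ n * M.charpoly.eval (-1) := by
  haveI : Nonempty (Fin n) := ⟨⟨0, hn⟩⟩
  have hroot : ∀ t : ℝ, 1 ≤ |t| → M.charpoly.eval t ≠ 0 := by
    intro t ht h0
    have := hM (t : ℂ) (by
      have h1 : Polynomial.IsRoot M.charpoly t := h0
      exact h1.map (f := algebraMap ℝ ℂ))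
    rw [Complex.norm_real, Real.norm_eq_abs] at this
    linarith
  have hnd : M.charpoly.natDegree = n := by simp [Matrix.charpoly_natDegree_eq_dim]
  have hmon := M.charpoly_monic
  refine ⟨fun x hx => aux_pos _ hmon (Polynomial.natDegree_pos_iff_degree_pos.mp (by omega))
    (fun t ht => hroot t (ht.trans (le_abs_self t))) x hx, ?_⟩
  have hm2 := hmon.neg_one_pow_natDegree_mul_comp_neg_X
  rw [hnd] at hm2
  have hev : ∀ t : ℝ, ((-1) ^ n * M.charpoly.comp (-X)).eval t
      = (-1 : ℝ) ^ n * M.charpoly.eval (-t) := by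
    intro t; simp
  have hdeg : ((-1) ^ n * M.charpoly.comp (-X)).natDegree = n := by
    have e : ((-1 : ℝ[X]) ^ n) = C ((-1 : ℝ) ^ n) := by simp
    rw [e, Polynomial.natDegree_C_mul (by simp), Polynomial.natDegree_comp, hnd]
    simp
  have := aux_pos _ hm2 (Polynomial.natDegree_pos_iff_degree_pos.mp (by omega))
    (fun t ht => by
      rw [hev]
      exact mul_ne_zero (by simp) (hroot _ (by rw [abs_neg]; exact ht.trans (le_abs_self t)))) 1 le_rfl
  rwa [hev] at this

theorem aux_eval_charpoly {n : ℕ} (M : Matrix (Fin n) (Fin n) ℝ) (z : ℝ) :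
    M.charpoly.eval z = (Matrix.scalar (Fin n) z - M).det := Matrix.eval_charpoly M z

theorem aux_at_r (k : ℕ) (hk : 1 ≤ k) (r v : ℝ) (K : Fin (k + 1) → ℝ) :
    (matA (k + 1) r v + Matrix.vecMulVec (vecB (k + 1) v 0) K).charpoly.eval r
      = - (K 0 * v ^ (k + 1)) := by
  rw [aux_eval_charpoly, Matrix.det_succ_column_zero, Finset.sum_eq_single (Fin.last k)]
  · rw [Matrix.det_of_lowerTriangular]
    · have hd : ∀ i : Fin k, ((Matrix.scalar (Fin (k + 1)) r - (matA (k + 1) r v +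
          Matrix.vecMulVec (vecB (k + 1) v 0) K)).submatrix (Fin.last k).succAbove Fin.succ) i i
          = - v := by
        intro i
        have hi := i.isLt
        have hne : i.castSucc ≠ i.succ := (Fin.castSucc_lt_succ (i := i)).ne
        simp [matA, vecB, Matrix.vecMulVec_apply, Matrix.diagonal_apply, hne]
        intro h1 h2
        omega
      rw [Finset.prod_congr rfl (fun i _ => hd i)]
      have hne : Fin.last k ≠ 0 := by
        intro h; have := congrArg Fin.val h; simp at this; omega
      have hk0 : k ≠ 0 := by omega
      simp [matA, vecB, Matrix.vecMulVec_apply, Matrix.diagonal_apply, hne, hk0]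
      rw [neg_pow v k]
      have : ((-1 : ℝ) ^ k) * (-1) ^ k = 1 := by rw [← mul_pow]; simp
      linear_combination (v * K 0 * v ^ k) * this
    · intro i j hij
      have hij' : i < j := hij
      have hlt : (i : ℕ) < j := hij'
      have hi := i.isLt
      have hne : i.castSucc ≠ j.succ := by
        intro h; have := congrArg Fin.val h; simp at this; omega
      have h2 : (j : ℕ) ≠ i := by omega
      simp [matA, vecB, Matrix.vecMulVec_apply, Matrix.diagonal_apply, hne, h2]
      intro h3 h4
      omega
  · intro i _ hi
    have hz : (Matrix.scalar (Fin (k + 1)) r - (matA (k + 1) r v +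
          Matrix.vecMulVec (vecB (k + 1) v 0) K)) i 0 = 0 := by
      have hi' : (i : ℕ) ≠ k := fun h => hi (Fin.ext h)
      by_cases h0 : i = 0
      · subst h0
        simp [matA, vecB, Matrix.vecMulVec_apply]
      · simp [matA, vecB, Matrix.vecMulVec_apply, Matrix.diagonal_apply, h0, hi']
    rw [hz]; simp
  · simp

theorem aux_diff (k : ℕ) (hk : 1 ≤ k) (r v m z : ℝ) (K : Fin (k + 1) → ℝ) :
    (matA (k + 1) r v + Matrix.vecMulVec (vecB (k + 1) v m) K).charpoly.eval z
      = (matA (k + 1) r v + Matrix.vecMulVec (vecB (k + 1) v 0) K).charpoly.eval z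
        - m * K 0 * z ^ k := by
  rw [aux_eval_charpoly, aux_eval_charpoly]
  set N := Matrix.scalar (Fin (k + 1)) z - (matA (k + 1) r v +
          Matrix.vecMulVec (vecB (k + 1) v 0) K) with hN
  have h1 : Matrix.scalar (Fin (k + 1)) z - (matA (k + 1) r v +
          Matrix.vecMulVec (vecB (k + 1) v m) K) = N.updateRow 0 (N 0 + (-m) • K) := by
    ext i j
    by_cases h0 : i = 0
    · subst h0
      simp [hN, matA, vecB, Matrix.vecMulVec_apply]
      ring
    · simp [hN, matA, vecB, Matrix.vecMulVec_apply, h0]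
  have h2 : (N.updateRow 0 K).det = ((Matrix.scalar (Fin (k + 1)) z - matA (k + 1) r v).updateRow 0 K).det := by
    apply Matrix.det_eq_of_forall_row_eq_smul_add_const
      (fun i => if i = 0 then 0 else - vecB (k + 1) v 0 i) 0 (by simp)
    intro i j
    by_cases h0 : i = 0
    · subst h0
      simp
    · simp [hN, Matrix.vecMulVec_apply, h0]
      ring
  have h3 : ((Matrix.scalar (Fin (k + 1)) z - matA (k + 1) r v).updateRow 0 K).det = K 0 * z ^ k := by
    rw [Matrix.det_of_upperTriangular]
    · rw [Fin.prod_univ_succ]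
      simp [matA]
    · intro i j hij
      have hij' : j < i := hij
      have hlt : (j : ℕ) < i := hij'
      have h0 : i ≠ 0 := by rintro rfl; simp at hlt
      have h4 : (j : ℕ) ≠ i + 1 := by omega
      simp [matA, h0, Matrix.diagonal_apply, hij'.ne', h4]
  rw [h1, Matrix.det_updateRow_add, Matrix.det_updateRow_smul, h2, h3, Matrix.updateRow_eq_self]
  ring

theorem stmt8 (n : ℕ) (hn : 2 ≤ n) (r v m : ℝ) (hr : 1 < r) (hv0 : 0 < v)
    (hv : v < (r - 1) / 2) (hm : 0 ≤ m) (K : Fin n → ℝ)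
    (hstab1 : IsStable (matA n r v + Matrix.vecMulVec (vecB n v 0) K))
    (p : Fin n → ℂ)
    (hfact : (Matrix.charpoly (matA n r v + Matrix.vecMulVec (vecB n v 0) K)).map
        (algebraMap ℝ ℂ) = ∏ i : Fin n, (X - C (p i)))
    (hmod : ∀ i, ‖p i‖ < 1)
    (hstab2 : IsStable (matA n r v + Matrix.vecMulVec (vecB n v m) K)) :
    m * (Matrix.charpoly (matA n r v + Matrix.vecMulVec (vecB n v 0) K)).eval r <
      v ^ n *
        ((-1 : ℝ) ^ n *
          (Matrix.charpoly (matA n r v + Matrix.vecMulVec (vecB n v 0) K)).eval (-1)) ∧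
    -- `χ(r) = ∏ᵢ (r − pᵢ)` and `(−1)ⁿ χ(−1) = ∏ᵢ (1 + pᵢ)` are positive reals, so that
    -- the conclusion reads `0 ≤ m < vⁿ ∏ᵢ (1 + pᵢ)/(r − pᵢ)`
    0 < (Matrix.charpoly (matA n r v + Matrix.vecMulVec (vecB n v 0) K)).eval r ∧
    0 < (-1 : ℝ) ^ n *
        (Matrix.charpoly (matA n r v + Matrix.vecMulVec (vecB n v 0) K)).eval (-1) ∧
    (((Matrix.charpoly (matA n r v + Matrix.vecMulVec (vecB n v 0) K)).eval r : ℝ) : ℂ) =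
      ∏ i : Fin n, ((r : ℂ) - p i) ∧
    (((-1 : ℝ) ^ n *
        (Matrix.charpoly (matA n r v + Matrix.vecMulVec (vecB n v 0) K)).eval (-1) : ℝ) : ℂ) =
      ∏ i : Fin n, (1 + p i) := by
  have hn0 : 0 < n := by omega
  obtain ⟨hp1, hp2⟩ := aux_pos_stable hn0 _ hstab1
  have hq2 := (aux_pos_stable hn0 _ hstab2).2
  have hev : ∀ t : ℝ, (((Matrix.charpoly (matA n r v +
      Matrix.vecMulVec (vecB n v 0) K)).eval t : ℝ) : ℂ) = ∏ i : Fin n, ((t : ℂ) - p i) := by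
    intro t
    have h := congrArg (Polynomial.eval (t : ℂ)) hfact
    rw [Polynomial.eval_prod] at h
    simp only [eval_sub, eval_X, eval_C] at h
    rw [← h]
    simpa using (Polynomial.eval_map_apply (algebraMap ℝ ℂ) t).symm
  refine ⟨?_, hp1 r hr.le, hp2, hev r, ?_⟩
  · obtain ⟨k, rfl⟩ : ∃ k, n = k + 1 := ⟨n - 1, by omega⟩
    rw [aux_diff k (by omega)] at hq2
    rw [aux_at_r k (by omega)]
    have hs : ((-1 : ℝ) ^ k) * (-1) ^ k = 1 := by rw [← mul_pow]; simp
    have hvp : 0 < v ^ (k + 1) := pow_pos hv0 _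
    have hmul := mul_pos hvp hq2
    have e : (-1 : ℝ) ^ (k + 1) * (m * K 0 * (-1) ^ k) = - (m * K 0) := by
      rw [pow_succ]; linear_combination (-(m * K 0)) * hs
    rw [mul_sub, e] at hmul
    linarith
  · rw [Complex.ofReal_mul, hev (-1)]
    push_cast
    have : ∀ i, (1 + p i) = (-1) * ((-1 : ℂ) - p i) := by intro i; ring
    rw [Finset.prod_congr rfl (fun i _ => this i), Finset.prod_mul_distrib]
    simp
end
end

section
/- Assume r > 1 and 0 < v < (r−1)/2, and set m = 2(2v/(r−1))ⁿ. Then the systems (A,B₁) and (A,B₂) are not co-stabilizable: there exists no K ∈ ℝ^{1×n} such that both A + B₁K and A + B₂K are stable. -/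
open Matrix Polynomial

noncomputable section

theorem trace_bound {n : ℕ} (M : Matrix (Fin n) (Fin n) ℝ) (h : IsStable M) :
    |M.trace| ≤ n := by
  have h1 := Matrix.trace_eq_sum_roots_charpoly (M.map (algebraMap ℝ ℂ))
  have h2 : (M.map (algebraMap ℝ ℂ)).trace = ((M.trace : ℝ) : ℂ) := by
    simp [Matrix.trace]
  have hc : (M.map (algebraMap ℝ ℂ)).charpoly = M.charpoly.map (algebraMap ℝ ℂ) :=
    Matrix.charpoly_map M _
  rw [h2, hc] at h1
  have h3 : |M.trace| = ‖((M.trace : ℝ) : ℂ)‖ := by simp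
  rw [h3, h1]
  have hcard : Multiset.card (M.charpoly.map (algebraMap ℝ ℂ)).roots ≤ n := by
    refine (Polynomial.card_roots' _).trans ?_
    refine Polynomial.natDegree_map_le.trans ?_
    simp [Matrix.charpoly_natDegree_eq_dim]
  have key : ∀ s : Multiset ℂ, (∀ z ∈ s, ‖z‖ < 1) → ‖s.sum‖ ≤ Multiset.card s := by
    intro s
    induction s using Multiset.induction_on with
    | empty => simp
    | cons a s ih =>
      intro hs
      have ha := hs a (by simp)
      have := ih (fun z hz => hs z (by simp [hz]))
      have h4 := norm_add_le a s.sum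
      simp only [Multiset.sum_cons, Multiset.card_cons, Nat.cast_add, Nat.cast_one]
      linarith
  refine (key _ ?_).trans (by exact_mod_cast hcard)
  intro z hz
  exact h z (Polynomial.isRoot_of_mem_roots hz)

theorem eval_bound {n : ℕ} (M : Matrix (Fin n) (Fin n) ℝ) (h : IsStable M) (r : ℝ)
    (hr : 1 < r) : (r - 1) ^ n ≤ |M.charpoly.eval r| := by
  set p := M.charpoly.map (algebraMap ℝ ℂ) with hp
  have hm : p.Monic := (Matrix.charpoly_monic M).map _
  have hs : p.Splits := IsAlgClosed.splits p
  have hdeg : p.natDegree = n := by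
    rw [hp, (Matrix.charpoly_monic M).natDegree_map]
    simp [Matrix.charpoly_natDegree_eq_dim]
  have hcard : Multiset.card p.roots = n := by
    rw [← hs.natDegree_eq_card_roots, hdeg]
  have he : p.eval (r : ℂ) = (p.roots.map (fun a => (r : ℂ) - a)).prod := by
    exact hs.eval_eq_prod_roots_of_monic hm _
  have he2 : p.eval (r : ℂ) = ((M.charpoly.eval r : ℝ) : ℂ) := by
    rw [hp]
    exact Polynomial.eval_map_apply (algebraMap ℝ ℂ) r
  have h3 : |M.charpoly.eval r| = ‖p.eval (r : ℂ)‖ := by rw [he2]; simp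
  rw [h3, he]
  have key : ∀ s : Multiset ℂ, (∀ z ∈ s, ‖z‖ < 1) →
      (r - 1) ^ (Multiset.card s) ≤ ‖(s.map (fun a => (r : ℂ) - a)).prod‖ := by
    intro s
    induction s using Multiset.induction_on with
    | empty => simp
    | cons a s ih =>
      intro hs
      have ha := hs a (by simp)
      have := ih (fun z hz => hs z (by simp [hz]))
      have h4 := norm_sub_norm_le (r : ℂ) a
      have h5 : ‖(r : ℂ)‖ = r := by simp; linarith
      simp only [Multiset.map_cons, Multiset.prod_cons, Multiset.card_cons, norm_mul]
      rw [pow_succ']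
      apply mul_le_mul _ this (pow_nonneg (by linarith) _) (norm_nonneg _)
      linarith
  have := key p.roots (fun z hz => h z (Polynomial.isRoot_of_mem_roots hz))
  rwa [hcard] at this

theorem eval_formula (k : ℕ) (r v : ℝ) (K : Fin (k + 2) → ℝ) :
    |(matA (k + 2) r v + Matrix.vecMulVec (vecB (k + 2) v 0) K).charpoly.eval r|
      = |K 0| * |v| ^ (k + 2) := by
  rw [Matrix.eval_charpoly, Matrix.det_succ_column_zero, Finset.sum_eq_single (Fin.last (k + 1))]
  · rw [Matrix.det_of_lowerTriangular]
    · have : ∀ i : Fin (k + 1), ((Matrix.scalar (Fin (k + 2))) r - (matA (k + 2) r v +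
          Matrix.vecMulVec (vecB (k + 2) v 0) K)).submatrix (Fin.last (k + 1)).succAbove Fin.succ i i
          = - v := by
        intro i
        have := i.2
        have hne : i.castSucc ≠ i.succ := by simp [Fin.ext_iff]
        simp [matA, vecB, Matrix.vecMulVec_apply, Matrix.diagonal_apply, hne]
        intros; omega
      rw [Finset.prod_congr rfl (fun i _ => this i)]
      simp [matA, vecB, Matrix.vecMulVec_apply, Matrix.diagonal_apply, abs_mul]
      ring
    · intro i j hij
      have hij' : (i : ℕ) < j := by simpa using hij
      have := j.2
      have hne : i.castSucc ≠ j.succ := by simp [Fin.ext_iff]; omega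
      have h1 : (i : ℕ) ≠ k + 1 := by omega
      have h2 : (j : ℕ) ≠ i := by omega
      simp [matA, vecB, Matrix.vecMulVec_apply, Matrix.diagonal_apply, hne, h1, h2]
  · intro i _ hi
    have hi' : (i : ℕ) ≠ k + 1 := by simpa [Fin.ext_iff] using hi
    by_cases h0 : i = 0
    · subst h0
      simp [matA, vecB, Matrix.vecMulVec_apply]
    · simp [matA, vecB, Matrix.vecMulVec_apply, Matrix.diagonal_apply, h0, hi']
  · simp

theorem trace_formula (k : ℕ) (r v m : ℝ) (K : Fin (k + 2) → ℝ) :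
    (matA (k + 2) r v + Matrix.vecMulVec (vecB (k + 2) v m) K).trace
      - (matA (k + 2) r v + Matrix.vecMulVec (vecB (k + 2) v 0) K).trace = m * K 0 := by
  simp [Matrix.trace_add, Matrix.trace_vecMulVec, dotProduct, Fin.sum_univ_succ, vecB]

theorem stmt9 (n : ℕ) (hn : 2 ≤ n) (r v : ℝ) (hr : 1 < r) (hv0 : 0 < v)
    (hv : v < (r - 1) / 2) :
    ¬ ∃ K : Fin n → ℝ,
        IsStable (matA n r v + Matrix.vecMulVec (vecB n v 0) K) ∧
        IsStable (matA n r v +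
          Matrix.vecMulVec (vecB n v (2 * (2 * v / (r - 1)) ^ n)) K) := by
  rintro ⟨K, h1, h2⟩
  obtain ⟨k, rfl⟩ : ∃ k, n = k + 2 := ⟨n - 2, by omega⟩
  have a1 := trace_bound _ h1
  have a2 := trace_bound _ h2
  have a3 := eval_bound _ h1 r hr
  rw [eval_formula, abs_of_pos hv0] at a3
  have a4 := trace_formula k r v (2 * (2 * v / (r - 1)) ^ (k + 2)) K
  set m := 2 * (2 * v / (r - 1)) ^ (k + 2) with hm
  have hr0 : 0 < r - 1 := by linarith
  have hm0 : 0 < m := by positivity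
  have a5 : m * |K 0| ≤ 2 * ((k + 2 : ℕ) : ℝ) := by
    rw [← abs_of_pos hm0, ← abs_mul, ← a4]
    rw [abs_le] at a1 a2 ⊢
    constructor <;> linarith [a1.1, a1.2, a2.1, a2.2]
  have a6 : 2 * 2 ^ (k + 2) ≤ m * |K 0| := by
    have : m * |K 0| = 2 * 2 ^ (k + 2) * (|K 0| * v ^ (k + 2)) / (r - 1) ^ (k + 2) := by
      rw [hm, div_pow, mul_pow]; ring
    rw [this, le_div_iff₀ (by positivity)]
    gcongr
  have a7 : ((k + 2 : ℕ) : ℝ) < 2 ^ (k + 2) := by exact_mod_cast Nat.lt_two_pow_self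
  linarith
end
end
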